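/- For every integer i ≥ 2, the number of equivalence classes of the relation ∼ on the finite set S_i equals i/2 if i is even and (i−3)/2 if i is odd. -/

import Mathlib

/-- For `i ≥ 2`, the parameter set `S_i ⊆ ℕ × ℕ`: the pairs `(i-1, 0)` and
`(0, i-1)` when `i - 1` is odd, together with all pairs `(μ₁, μ₂)` with
`μ₁, μ₂ ≥ 2`, `μ₁ + μ₂ = i - 1`, and at least one of `μ₁, μ₂` even. -/
def torsionParams (i : ℕ) : Set (ℕ × ℕ) :=
  {p | Odd (i - 1) ∧ (p = (i - 1, 0) ∨ p = (0, i - 1))} ∪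
  {p | 2 ≤ p.1 ∧ 2 ≤ p.2 ∧ p.1 + p.2 = i - 1 ∧ (Even p.1 ∨ Even p.2)}

/-- The generating relations on `S_i`: `(1,0) ∼ (0,1)`;
`(μ₁,μ₂) ∼ (μ₁+1, μ₂-1)` whenever `μ₁` is even and `μ₂` is odd; and
`(μ₁,μ₂) ∼ (μ₁-1, μ₂+1)` whenever `μ₂` is even and `μ₁` is odd
(both sides being required to lie in `S_i` since the relation lives on the
subtype `↥(S_i)`). -/
def torsionRel (i : ℕ) (a b : torsionParams i) : Prop :=
  ((a : ℕ × ℕ) = (1, 0) ∧ (b : ℕ × ℕ) = (0, 1)) ∨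
  (Even (a : ℕ × ℕ).1 ∧ Odd (a : ℕ × ℕ).2 ∧
    (b : ℕ × ℕ) = ((a : ℕ × ℕ).1 + 1, (a : ℕ × ℕ).2 - 1)) ∨
  (Odd (a : ℕ × ℕ).1 ∧ Even (a : ℕ × ℕ).2 ∧
    (b : ℕ × ℕ) = ((a : ℕ × ℕ).1 - 1, (a : ℕ × ℕ).2 + 1))

theorem mem_torsionParams {i x y : ℕ} :
    (x, y) ∈ torsionParams i ↔
      Odd (i - 1) ∧ (x = i - 1 ∧ y = 0 ∨ x = 0 ∧ y = i - 1) ∨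
        2 ≤ x ∧ 2 ≤ y ∧ x + y = i - 1 ∧ (Even x ∨ Even y) := by
  simp [torsionParams]

theorem torsionRel.fst_div_two_eq {i : ℕ} {a b : torsionParams i} (h : torsionRel i a b) :
    a.1.1 / 2 = b.1.1 / 2 := by
  obtain ⟨⟨x, y⟩, ha⟩ := a
  obtain ⟨⟨z, w⟩, hb⟩ := b
  simp only [torsionRel, Prod.mk.injEq, Nat.even_iff, Nat.odd_iff] at h ⊢
  omega

theorem eq_or_torsionRel_of_fst_div_two_eq {i : ℕ} {a b : torsionParams i}
    (h : a.1.1 / 2 = b.1.1 / 2) : a = b ∨ torsionRel i a b ∨ torsionRel i b a := by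
  obtain ⟨⟨x, y⟩, ha⟩ := a
  obtain ⟨⟨z, w⟩, hb⟩ := b
  simp only [mem_torsionParams, torsionRel, Subtype.mk.injEq, Prod.mk.injEq, Nat.even_iff,
    Nat.odd_iff] at ha hb h ⊢
  obtain hxz | hxz | hxz : x = z ∨ z = x + 1 ∧ x % 2 = 0 ∨ x = z + 1 ∧ z % 2 = 0 := by omega
  · left
    omega
  · right; left
    rcases ha with ha | ha <;> rcases hb with hb | hb <;> omega
  · right; right
    rcases ha with ha | ha <;> rcases hb with hb | hb <;> omega

theorem eqvGen_torsionRel_eq_ker (i : ℕ) :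
    Relation.EqvGen.setoid (torsionRel i) =
      Setoid.ker fun a : torsionParams i ↦ a.1.1 / 2 := by
  apply le_antisymm
  · exact Setoid.eqvGen_le fun _ _ h ↦ h.fst_div_two_eq
  · intro a b h
    rcases eq_or_torsionRel_of_fst_div_two_eq h with rfl | h | h
    · exact .refl _
    · exact .rel _ _ h
    · exact .symm _ _ (.rel _ _ h)

theorem range_fst_div_two {i : ℕ} (hi : 2 ≤ i) :
    Set.range (fun a : torsionParams i ↦ a.1.1 / 2) =
      ((if Even i then Finset.range (i / 2) else Finset.Ico 1 ((i - 1) / 2) : Finset ℕ) :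
        Set ℕ) := by
  ext k
  simp only [Set.mem_range, Subtype.exists, Prod.exists, mem_torsionParams, Finset.mem_coe,
    exists_prop, Nat.even_iff, Nat.odd_iff]
  constructor
  · rintro ⟨x, y, h, rfl⟩
    split_ifs <;> simp only [Finset.mem_range, Finset.mem_Ico] <;> omega
  · intro hk
    by_cases hlast : i % 2 = 0 ∧ k = i / 2 - 1
    · exact ⟨i - 1, 0, by omega, by omega⟩
    · refine ⟨2 * k, i - 1 - 2 * k, ?_, by omega⟩
      split_ifs at hk <;> simp only [Finset.mem_range, Finset.mem_Ico] at hk <;> omega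

/--
For every integer `i ≥ 2`, the number of equivalence classes
of the equivalence relation generated by `torsionRel i` on the finite set
`S_i` equals `i / 2` if `i` is even and `(i - 3) / 2` if `i` is odd.
-/
theorem card_torsion_classes (i : ℕ) (hi : 2 ≤ i) :
    Nat.card (Quotient (Relation.EqvGen.setoid (torsionRel i))) =
      if Even i then i / 2 else (i - 3) / 2 := by
  rw [eqvGen_torsionRel_eq_ker, Nat.card_congr (Setoid.quotientKerEquivRange _),
    range_fst_div_two hi, Nat.card_coe_set_eq, Set.ncard_coe_finset]
  split_ifs
  · exact Finset.card_range _
  · rw [Nat.card_Ico]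
    omega
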